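/- arXiv:1407.5959 — 2 statements merged into one kernel-verified Lean document; each statement's English description precedes it below -/
import Mathlib

section
/- For all integers k ≥ 1 and k+2 ≤ n ≤ 2k+2, the domination polynomial of the (k,n)-path satisfies the recurrence D(P^k_n, x) = (1+x)·D(P^k_{n−1}, x) + x·D(P^k_{n−k−1}, x) − (1+x)·x·(1+x)^{n−k−2} as polynomials in x. -/
open Polynomial

/-- `S` is a dominating set of `G`. -/
def IsDomSet {V : Type*} (G : SimpleGraph V) (S : Finset V) : Prop :=
  ∀ v : V, v ∉ S → ∃ u ∈ S, G.Adj u v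

/-- The domination number of `G`. -/
noncomputable def domNum {V : Type*} [Fintype V] (G : SimpleGraph V) : ℕ :=
  sInf {i : ℕ | ∃ S : Finset V, IsDomSet G S ∧ S.card = i}

open scoped Classical in
/-- The domination polynomial of `G`, `D(G,x) = Σ_S x^{|S|}` over dominating sets `S`. -/
noncomputable def domPoly {V : Type*} [Fintype V] (G : SimpleGraph V) : Polynomial ℤ :=
  ∑ S ∈ Finset.univ.filter (fun S : Finset V => IsDomSet G S), (X : Polynomial ℤ) ^ S.card

/-- The `(k,n)`-path: vertices `v_1,…,v_n`, distinct `v_i, v_j` adjacent iff `|i-j| ≤ k`. -/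
def kPath (k n : ℕ) : SimpleGraph (Fin n) :=
  SimpleGraph.fromRel (fun i j => |(i.val : ℤ) - (j.val : ℤ)| ≤ (k : ℤ))

/-- The `(k,n)`-cycle: distinct `v_i, v_j` adjacent iff `|i-j| ≤ k` or `{i,j} = {1,n}`. -/
def kCycle (k n : ℕ) : SimpleGraph (Fin n) :=
  SimpleGraph.fromRel (fun i j =>
    |(i.val : ℤ) - (j.val : ℤ)| ≤ (k : ℤ) ∨ |(i.val : ℤ) - (j.val : ℤ)| = (n : ℤ) - 1)

/-- The `(k,n)`-wheel: the `(k,n)`-cycle joined with one extra vertex (the last vertex,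
of index `n`) adjacent to all others. -/
def kWheel (k n : ℕ) : SimpleGraph (Fin (n + 1)) :=
  SimpleGraph.fromRel (fun i j =>
    (i.val < n ∧ j.val < n ∧
      (|(i.val : ℤ) - (j.val : ℤ)| ≤ (k : ℤ) ∨ |(i.val : ℤ) - (j.val : ℤ)| = (n : ℤ) - 1)) ∨
    j.val = n)

/-- The `(k,n)`-star on `n` vertices: `K_k + \bar K_{n-k}`; the first `k` vertices form a
clique, the rest are independent, and every clique vertex is joined to every other vertex. -/
def kStar (k n : ℕ) : SimpleGraph (Fin n) :=
  SimpleGraph.fromRel (fun i _ => i.val < k)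

/-- The corona `G ∘ H`. -/
def corona {V W : Type*} (G : SimpleGraph V) (H : SimpleGraph W) :
    SimpleGraph (V ⊕ V × W) :=
  SimpleGraph.fromRel (fun a b =>
    (∃ u v, a = Sum.inl u ∧ b = Sum.inl v ∧ G.Adj u v) ∨
    (∃ u w w', a = Sum.inr (u, w) ∧ b = Sum.inr (u, w') ∧ H.Adj w w') ∨
    (∃ u w, a = Sum.inl u ∧ b = Sum.inr (u, w)))

theorem sum_powerset_X_pow_card {V : Type*} (A : Finset V) :
    ∑ S ∈ A.powerset, (X : Polynomial ℤ) ^ S.card = (1 + X) ^ A.card := by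
  rw [add_comm, ← Finset.sum_pow_mul_eq_add_pow]
  simp

/-- If the dominating sets are exactly the sets contained in neither of two disjoint sets,
inclusion–exclusion gives the domination polynomial. -/
theorem domPoly_eq_of_isDomSet_iff {V : Type*} [Fintype V] {G : SimpleGraph V}
    {A B : Finset V} (hAB : Disjoint A B)
    (h : ∀ S, IsDomSet G S ↔ ¬ S ⊆ A ∧ ¬ S ⊆ B) :
    domPoly G = (1 + X) ^ Fintype.card V - (1 + X) ^ A.card - (1 + X) ^ B.card + 1 := by
  classical
  have hsum (C : Finset V) : (1 + X : Polynomial ℤ) ^ C.card =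
      ∑ S : Finset V, if S ⊆ C then (X : Polynomial ℤ) ^ S.card else 0 := by
    rw [← sum_powerset_X_pow_card, ← Finset.sum_filter]
    congr 1
    ext S
    simp
  have hone : (1 : Polynomial ℤ) =
      ∑ S : Finset V, if S ⊆ A ∧ S ⊆ B then (X : Polynomial ℤ) ^ S.card else 0 := by
    simp [← Finset.subset_inter_iff, Finset.disjoint_iff_inter_eq_empty.mp hAB]
  rw [domPoly, Finset.sum_filter, ← Finset.card_univ, hsum Finset.univ, hsum A, hsum B]
  rw [hone, ← Finset.sum_sub_distrib, ← Finset.sum_sub_distrib, ← Finset.sum_add_distrib]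
  refine Finset.sum_congr rfl fun S _ => ?_
  by_cases hA : S ⊆ A <;> by_cases hB : S ⊆ B <;> simp [h, hA, hB]

theorem kPath_adj {k n : ℕ} {i j : Fin n} :
    (kPath k n).Adj i j ↔ i ≠ j ∧ i.val ≤ j.val + k ∧ j.val ≤ i.val + k := by
  simp only [kPath, SimpleGraph.fromRel_adj, abs_le]
  refine and_congr_right fun _ => ?_
  omega

/-- When `n ≤ 2k + 2`, it suffices to dominate the two end vertices. -/
theorem isDomSet_kPath_iff {k n : ℕ} (hn : 1 ≤ n) (hn2 : n ≤ 2 * k + 2) (S : Finset (Fin n)) :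
    IsDomSet (kPath k n) S ↔
      ¬ S ⊆ Finset.univ.filter (fun i : Fin n => k < i.val) ∧
      ¬ S ⊆ Finset.univ.filter (fun i : Fin n => i.val + k + 1 < n) := by
  simp only [Finset.subset_iff, Finset.mem_filter, Finset.mem_univ, true_and]
  constructor
  · intro h
    constructor
    · intro hS
      obtain ⟨u, hu, huv⟩ := h ⟨0, hn⟩ fun h0 => by simpa using hS h0
      have := hS hu
      have := (kPath_adj.mp huv).2.1
      simp only at this
      omega
    · intro hS
      obtain ⟨u, hu, huv⟩ := h ⟨n - 1, by omega⟩ fun h1 => by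
        have := hS h1
        simp only at this
        omega
      have := hS hu
      have := (kPath_adj.mp huv).2.2
      simp only at this
      omega
  · rintro ⟨hA, hB⟩ v hv
    push Not at hA hB
    obtain ⟨a, ha, hak⟩ := hA
    obtain ⟨b, hb, hbk⟩ := hB
    rcases le_or_gt v.val k with hvk | hvk
    · exact ⟨a, ha, kPath_adj.mpr ⟨fun e => hv (e ▸ ha), by omega, by omega⟩⟩
    · exact ⟨b, hb, kPath_adj.mpr ⟨fun e => hv (e ▸ hb), by omega, by omega⟩⟩

/-- Closed form of the domination polynomial of short `(k,n)`-paths. -/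
theorem domPoly_kPath_of_le {k n : ℕ} (hn : 1 ≤ n) (hn2 : n ≤ 2 * k + 2) :
    domPoly (kPath k n) = (1 + X) ^ n - 2 * (1 + X) ^ (n - k - 1) + 1 := by
  have hB : (Finset.univ.filter (fun i : Fin n => i.val + k + 1 < n)).card = n - k - 1 := by
    simp_rw [show ∀ i : Fin n, i.val + k + 1 < n ↔ i.val < n - k - 1 by omega]
    rw [Fin.card_filter_val_lt]
    omega
  have hA : (Finset.univ.filter (fun i : Fin n => k < i.val)).card = n - k - 1 := by
    rw [← hB]
    refine Finset.card_equiv Fin.revPerm fun i => ?_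
    simp only [Finset.mem_filter, Finset.mem_univ, true_and, Fin.revPerm_apply, Fin.val_rev]
    omega
  rw [domPoly_eq_of_isDomSet_iff _ (isDomSet_kPath_iff hn hn2), hA, hB, Fintype.card_fin]
  · ring
  · refine Finset.disjoint_filter.mpr fun i _ h => ?_
    omega

theorem domPoly_kPath_rec_small (k n : ℕ) (hk : 1 ≤ k) (hn1 : k + 2 ≤ n)
    (hn2 : n ≤ 2 * k + 2) :
    domPoly (kPath k n) =
      (1 + X) * domPoly (kPath k (n - 1)) + X * domPoly (kPath k (n - k - 1)) -
        (1 + X) * (X * (1 + X) ^ (n - k - 2)) := by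
  obtain ⟨m, rfl⟩ := Nat.exists_eq_add_of_le hn1
  rw [domPoly_kPath_of_le (by omega) hn2, domPoly_kPath_of_le (by omega) (by omega),
    domPoly_kPath_of_le (by omega) (by omega),
    show k + 2 + m - 1 = k + 1 + m by omega, show k + 2 + m - k - 1 = m + 1 by omega,
    show k + 1 + m - k - 1 = m by omega, show m + 1 - k - 1 = 0 by omega,
    show k + 2 + m - k - 2 = m by omega]
  ring
end

section
/- For all integers n > k ≥ 1, the domination polynomial of the (k,n)-star evaluated at −1 satisfies D(S_{k,n−k}, −1) = (−1)^{n−k}. -/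
open Polynomial

theorem isDomSet_kStar_iff {k n : ℕ} (hn : k < n) (S : Finset (Fin n)) :
    IsDomSet (kStar k n) S ↔
      S = Finset.univ.filter (fun i : Fin n => k ≤ i.val) ∨
        ¬ S ⊆ Finset.univ.filter (fun i : Fin n => k ≤ i.val) := by
  simp only [IsDomSet, kStar, SimpleGraph.fromRel_adj]
  constructor
  · intro h
    by_contra! hS
    obtain ⟨hne, hsub⟩ := hS
    refine hne (hsub.antisymm fun v hv => ?_)
    by_contra hvS
    obtain ⟨u, hu, -, huv⟩ := h v hvS
    have hku := (Finset.mem_filter.mp (hsub hu)).2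
    have hkv := (Finset.mem_filter.mp hv).2
    omega
  · rintro (rfl | h) v hv
    · simp only [Finset.mem_filter, Finset.mem_univ, true_and, not_le] at hv ⊢
      exact ⟨⟨k, hn⟩, le_rfl, fun h => hv.ne (congrArg Fin.val h).symm, Or.inr hv⟩
    · obtain ⟨u, hu, hku⟩ := Finset.not_subset.mp h
      simp only [Finset.mem_filter, Finset.mem_univ, true_and, not_le] at hku
      exact ⟨u, hu, fun h => hv (h ▸ hu), Or.inl hku⟩

theorem domPoly_kStar_eval_neg_one (k n : ℕ) (hk : 1 ≤ k) (hn : k < n) :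
    (domPoly (kStar k n)).eval (-1) = (-1 : ℤ) ^ (n - k) := by
  classical
  set B : Finset (Fin n) := Finset.univ.filter (fun i : Fin n => k ≤ i.val) with hB
  have hBcard : B.card = n - k := by
    have : B = Finset.Ici (⟨k, hn⟩ : Fin n) := by
      ext i
      simp [hB, Fin.le_def]
    rw [this, Fin.card_Ici]
  have hBne : B.Nonempty := Finset.card_pos.mp (by omega)
  have hne : (Finset.univ : Finset (Fin n)).Nonempty := ⟨⟨k, hn⟩, Finset.mem_univ _⟩
  have hdom : Finset.univ.filter (fun S : Finset (Fin n) => IsDomSet (kStar k n) S) =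
      insert B (Finset.univ \ B.powerset) := by
    ext S
    simp [isDomSet_kStar_iff hn, ← hB]
  have hall : ∑ S : Finset (Fin n), (-1 : ℤ) ^ S.card = 0 := by
    rw [← Finset.powerset_univ, Finset.sum_powerset_neg_one_pow_card_of_nonempty hne]
  have hsub := Finset.sum_powerset_neg_one_pow_card_of_nonempty hBne
  have hsplit := Finset.sum_sdiff (f := fun S : Finset (Fin n) => (-1 : ℤ) ^ S.card)
    (Finset.subset_univ B.powerset)
  have heval : (domPoly (kStar k n)).eval (-1) =
      ∑ S ∈ insert B (Finset.univ \ B.powerset), (-1 : ℤ) ^ S.card := by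
    rw [← hdom, domPoly, eval_finsetSum]
    simp only [eval_pow, eval_X]
  rw [heval, Finset.sum_insert (by simp), hBcard]
  linarith
end
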